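/- For every n ≥ 0, the number of intervals of the Tamari lattice of size n, i.e. the number of ordered pairs (T, T') of binary trees of size n with T ≤ T' in the Tamari order, equals 2·(4n+1)! / ((n+1)!·(3n+2)!). -/

import Mathlib

open Polynomial

/-- A binary tree: either the empty tree or a pair of binary trees
(left and right subtrees) grafted on an internal node. -/
inductive BinTree : Type
  | leaf : BinTree
  | node : BinTree → BinTree → BinTree

namespace BinTree

/-- The size of a binary tree: its number of internal nodes. -/
def size : BinTree → ℕ
  | leaf => 0
  | node l r => l.size + r.size + 1

/-- One right rotation somewhere in the tree: `Rot T T'` means that `T'` is obtained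
from `T` by replacing one subtree of the form `y(x(A,B),C)` by `x(A,y(B,C))`. -/
inductive Rot : BinTree → BinTree → Prop
  | root (A B C : BinTree) : Rot (node (node A B) C) (node A (node B C))
  | left {L L' : BinTree} (R : BinTree) : Rot L L' → Rot (node L R) (node L' R)
  | right (L : BinTree) {R R' : BinTree} : Rot R R' → Rot (node L R) (node L R')

/-- The Tamari order: `TamariLE T T'` iff `T'` is obtained from `T` by a (possibly empty)
sequence of right rotations. -/
def TamariLE (T T' : BinTree) : Prop := Relation.ReflTransGen Rot T T'

/-- The Tamari polynomial `B_T ∈ ℤ[x]`: `B_∅ = 1` and for `T = x(L,R)`, `B_T` is the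
unique polynomial with `(x-1)·B_T = x·B_L·(x·B_R - B_R(1))` (exact division by the
monic polynomial `X - 1`, the right-hand side vanishing at `x = 1`). -/
noncomputable def tamPoly : BinTree → Polynomial ℤ
  | leaf => 1
  | node l r =>
      (X * tamPoly l * (X * tamPoly r - C ((tamPoly r).eval 1))) /ₘ (X - C 1)

/-- The mirror Tamari polynomial, obtained by exchanging the roles of the left and
right subtrees in the recursive definition of the Tamari polynomial. -/
noncomputable def tamPolyMirror : BinTree → Polynomial ℤ
  | leaf => 1
  | node l r =>
      (X * tamPolyMirror r * (X * tamPolyMirror l - C ((tamPolyMirror l).eval 1))) /ₘ (X - C 1)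

/-- The number of nodes on the left border of a binary tree. -/
def leftBorder : BinTree → ℕ
  | leaf => 0
  | node l _ => l.leftBorder + 1

/-- The number of nodes on the right border of a binary tree. -/
def rightBorder : BinTree → ℕ
  | leaf => 0
  | node _ r => r.rightBorder + 1

/-- `inSub T a b`: in the unique binary-search-tree labelling of `T` by `1,…,size T`
(all labels of the left subtree of a node are smaller than its label, all labels of its
right subtree are larger), the node labelled `a` belongs to the subtree rooted at the
node labelled `b` (in particular `inSub T a a` holds for every node label `a`). -/
def inSub : BinTree → ℕ → ℕ → Prop
  | leaf => fun _ _ => False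
  | node l r => fun a b =>
      (b = l.size + 1 ∧ 1 ≤ a ∧ a ≤ l.size + r.size + 1) ∨
      inSub l a b ∨
      (l.size + 1 < a ∧ l.size + 1 < b ∧ inSub r (a - (l.size + 1)) (b - (l.size + 1)))

/-- The binary search tree poset of `T`: `bstRel T a b` iff `a ≺_T b`, i.e. `a ≠ b` and
the node labelled `a` is in the subtree rooted at the node labelled `b`. -/
def bstRel (T : BinTree) (a b : ℕ) : Prop := a ≠ b ∧ inSub T a b

/-- The increasing forest `inc(T)`: `a ≺ b` iff `a < b` and `a ≺_T b`. -/
def incRel (T : BinTree) (a b : ℕ) : Prop := a < b ∧ bstRel T a b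

/-- The decreasing forest `dec(T)`: `b ≺ a` iff `b > a` and `b ≺_T a`. -/
def decRel (T : BinTree) (a b : ℕ) : Prop := b < a ∧ bstRel T a b

/-- The relations of the interval-poset `IP[T,T']`: exactly those of `dec(T)`
together with those of `inc(T')`. -/
def IPrel (T T' : BinTree) (a b : ℕ) : Prop := decRel T a b ∨ incRel T' a b

end BinTree

open BinTree

/-- `σ` is a linear extension of the strict relation `rel` on `{1,…,n}`: reading the word
`σ(1)…σ(n)` (the `i`-th letter being the label `(σ i : ℕ) + 1`), whenever `rel a b` holds
the letter `a` appears before the letter `b`. -/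
def IsLinExt (n : ℕ) (rel : ℕ → ℕ → Prop) (σ : Equiv.Perm (Fin n)) : Prop :=
  ∀ i j : Fin n, rel ((σ i : ℕ) + 1) ((σ j : ℕ) + 1) → i < j

/-- An interval-poset of size `n`: a (strict) poset on `{1,…,n}` such that
`a ≺ c` implies `b ≺ c` for all `a < b < c`, and `c ≺ a` implies `b ≺ a` for all
`a < b < c`. -/
def IsIntervalPoset (n : ℕ) (rel : ℕ → ℕ → Prop) : Prop :=
  (∀ a b, rel a b → 1 ≤ a ∧ a ≤ n ∧ 1 ≤ b ∧ b ≤ n) ∧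
  (∀ a, ¬ rel a a) ∧
  (∀ a b c, rel a b → rel b c → rel a c) ∧
  (∀ a b c, a < b → b < c → rel a c → rel b c) ∧
  (∀ a b c, a < b → b < c → rel c a → rel b a)

/-- `trees(P)` : the number of connected components of the forest formed by the decreasing
relations of `P`, i.e. the number of `k ∈ {1,…,n}` such that there is no `j < k`
with `k ≺_P j`. -/
noncomputable def treeStat (n : ℕ) (rel : ℕ → ℕ → Prop) : ℕ :=
  Set.ncard {k : ℕ | 1 ≤ k ∧ k ≤ n ∧ ∀ j, j < k → ¬ rel k j}

/-- The composition `𝔹(I1,I2)` of two interval-posets of sizes `k1` and `k2`: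
the set of interval-posets `I` of size `k1+k2+1` such that
(i) the relations of `I` among `1,…,k1` are exactly those of `I1`,
(ii) the relations of `I` among `k1+2,…,k1+k2+1` are exactly those of `I2` shifted
by `k1+1`, (iii) `i ≺_I k1+1` for all `i ≤ k1`, and (iv) there is no relation
`k1+1 ≺_I j` for `j > k1+1`. -/
def Comp (k1 k2 : ℕ) (I1 I2 : ℕ → ℕ → Prop) : Set (ℕ → ℕ → Prop) :=
  {I | IsIntervalPoset (k1 + k2 + 1) I ∧
    (∀ a b, 1 ≤ a → a ≤ k1 → 1 ≤ b → b ≤ k1 → (I a b ↔ I1 a b)) ∧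
    (∀ a b, k1 + 2 ≤ a → a ≤ k1 + k2 + 1 → k1 + 2 ≤ b → b ≤ k1 + k2 + 1 →
      (I a b ↔ I2 (a - (k1 + 1)) (b - (k1 + 1)))) ∧
    (∀ i, 1 ≤ i → i ≤ k1 → I i (k1 + 1)) ∧
    (∀ j, k1 + 1 < j → ¬ I (k1 + 1) j)}

/-- The co-inversions of a permutation `σ` of `{1,…,n}` (written as the word
`σ(1)…σ(n)`): pairs `(σ(i), σ(j))` with `i < j` and `σ(i) > σ(j)`. -/
def coinv (n : ℕ) (σ : Equiv.Perm (Fin n)) : Set (Fin n × Fin n) :=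
  {p | ∃ i j : Fin n, i < j ∧ σ j < σ i ∧ p = (σ i, σ j)}


namespace BinTree

/-- `Ins L R T`: the tree `T` is obtained by inserting `L` on the left border of `R`. -/
inductive Ins (L : BinTree) : BinTree → BinTree → Prop
  | here (R : BinTree) : Ins L R (node L R)
  | up {A T : BinTree} (B : BinTree) : Ins L A T → Ins L (node A B) (node T B)

/-- Recursive description of the Tamari order. -/
inductive Le : BinTree → BinTree → Prop
  | leaf : Le leaf leaf
  | node {L' L R' R T' : BinTree} : Le L' L → Le R' R → Ins L' R' T' → Le T' (node L R)

theorem tam_left {L L' : BinTree} (R : BinTree) (h : TamariLE L L') :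
    TamariLE (node L R) (node L' R) := by
  unfold TamariLE at *
  induction h with
  | refl => exact .refl
  | tail _ h ih => exact ih.tail (.left R h)

theorem tam_right (L : BinTree) {R R' : BinTree} (h : TamariLE R R') :
    TamariLE (node L R) (node L R') := by
  unfold TamariLE at *
  induction h with
  | refl => exact .refl
  | tail _ h ih => exact ih.tail (.right L h)

theorem Ins.tam {L R T : BinTree} (h : Ins L R T) : TamariLE T (node L R) := by
  induction h with
  | here R => exact .refl
  | up B _ ih => exact (tam_left B ih).tail (.root _ _ _)

theorem Le.tam {T' T : BinTree} (h : Le T' T) : TamariLE T' T := by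
  induction h with
  | leaf => exact .refl
  | node _ _ hi ihl ihr => exact (hi.tam.trans (tam_left _ ihl)).trans (tam_right _ ihr)

theorem Le.rfl : ∀ T : BinTree, Le T T
  | .leaf => .leaf
  | .node L R => .node (Le.rfl L) (Le.rfl R) (.here R)

theorem Ins.assoc {A B L R T : BinTree} (h1 : Ins A B L) (h2 : Ins L R T) :
    ∃ Q, Ins B R Q ∧ Ins A Q T := by
  induction h2 with
  | here R => exact ⟨_, .here R, .up R h1⟩
  | up S _ ih =>
    obtain ⟨Q, hq, hq'⟩ := ih
    exact ⟨_, .up S hq, .up S hq'⟩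

theorem Le.rot {T T2 : BinTree} (h : Rot T T2) : ∀ {T' : BinTree}, Le T' T → Le T' T2 := by
  induction h with
  | root A B C =>
    intro T' h
    cases h with
    | node hl hr hi =>
      cases hl with
      | node ha hb hj =>
        obtain ⟨Q, hq, hq'⟩ := hj.assoc hi
        exact .node ha (.node hb hr hq) hq'
  | left R _ ih =>
    intro T' h
    cases h with
    | node hl hr hi => exact .node (ih hl) hr hi
  | right L _ ih =>
    intro T' h
    cases h with
    | node hl hr hi => exact .node hl (ih hr) hi

theorem tam_iff_le {T' T : BinTree} : TamariLE T' T ↔ Le T' T := by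
  refine ⟨fun h => ?_, Le.tam⟩
  unfold TamariLE at h
  induction h with
  | refl => exact .rfl _
  | tail _ h ih => exact .rot h ih

/-- Insertion of `L` at depth `d` of the left border. -/
def ins (L : BinTree) : ℕ → BinTree → BinTree
  | 0, R => node L R
  | _ + 1, leaf => leaf
  | d + 1, node A B => node (ins L d A) B

theorem Ins_iff {L R T : BinTree} : Ins L R T ↔ ∃ d, d ≤ R.leftBorder ∧ ins L d R = T := by
  constructor
  · intro h
    induction h with
    | here R => exact ⟨0, by simp, by simp [ins]⟩
    | up B _ ih =>
      obtain ⟨d, hd, he⟩ := ih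
      exact ⟨d + 1, by simp [leftBorder, hd], by simp [ins, he]⟩
  · rintro ⟨d, hd, rfl⟩
    induction d generalizing R with
    | zero => simp only [ins]; exact .here R
    | succ d ih =>
      cases R with
      | leaf => simp [leftBorder] at hd
      | node A B =>
        simp only [ins]
        exact .up B (ih (by simpa [leftBorder] using hd))

theorem size_ins {L : BinTree} : ∀ {d : ℕ} {R : BinTree}, d ≤ R.leftBorder →
    (ins L d R).size = L.size + R.size + 1
  | 0, R, _ => by simp [ins, size]
  | d + 1, leaf, h => by simp [leftBorder] at h
  | d + 1, node A B, h => by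
    have := size_ins (L := L) (d := d) (R := A) (by simpa [leftBorder] using h)
    simp only [ins, size, this]; ring

theorem leftBorder_ins {L : BinTree} : ∀ {d : ℕ} {R : BinTree}, d ≤ R.leftBorder →
    (ins L d R).leftBorder = L.leftBorder + 1 + d
  | 0, R, _ => by simp [ins, leftBorder]
  | d + 1, leaf, h => by simp [leftBorder] at h
  | d + 1, node A B, h => by
    have := leftBorder_ins (L := L) (d := d) (R := A) (by simpa [leftBorder] using h)
    simp only [ins, leftBorder, this]; ring

theorem ins_inj {L L2 : BinTree} (hs : L.size = L2.size) : ∀ {d d2 : ℕ} {R R2 : BinTree},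
    d ≤ R.leftBorder → d2 ≤ R2.leftBorder → ins L d R = ins L2 d2 R2 →
    L = L2 ∧ R = R2 ∧ d = d2
  | 0, 0, R, R2, _, _, h => by simpa [ins] using h
  | d + 1, _, leaf, _, h, _, _ => by simp [leftBorder] at h
  | _, d + 1, _, leaf, _, h, _ => by simp [leftBorder] at h
  | 0, d + 1, R, node A B, _, h, he => by
    simp only [ins, node.injEq] at he
    have := size_ins (L := L2) (d := d) (R := A) (by simpa [leftBorder] using h)
    rw [← he.1] at this
    omega
  | d + 1, 0, node A B, R, h, _, he => by
    simp only [ins, node.injEq] at he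
    have := size_ins (L := L) (d := d) (R := A) (by simpa [leftBorder] using h)
    rw [he.1] at this
    omega
  | d + 1, d2 + 1, node A B, node A2 B2, h, h2, he => by
    simp only [ins, node.injEq] at he
    have := ins_inj hs (d := d) (d2 := d2) (R := A) (R2 := A2)
      (by simpa [leftBorder] using h) (by simpa [leftBorder] using h2) he.1
    simp [this, he.2]

open Classical in
/-- The finite set of trees below a given tree. -/
noncomputable def lowers : BinTree → Finset BinTree
  | leaf => {leaf}
  | node L R =>
      ((lowers L ×ˢ lowers R).sigma fun p => Finset.range (p.2.leftBorder + 1)).image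
        fun q => ins q.1.1 q.2 q.1.2

theorem mem_lowers {T' T : BinTree} : T' ∈ lowers T ↔ Le T' T := by
  induction T generalizing T' with
  | leaf =>
    simp only [lowers, Finset.mem_singleton]
    exact ⟨fun h => h ▸ .leaf, fun h => by cases h; simp⟩
  | node L R ihl ihr =>
    simp only [lowers, Finset.mem_image, Finset.mem_sigma, Finset.mem_product, Finset.mem_range,
      ihl, ihr, Nat.lt_succ_iff]
    constructor
    · rintro ⟨⟨⟨L', R'⟩, d⟩, ⟨⟨hl, hr⟩, hd⟩, he⟩
      exact .node hl hr (Ins_iff.2 ⟨d, hd, he⟩)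
    · intro h
      cases h with
      | @node L' _ R' _ _ hl hr hi =>
        obtain ⟨d, hd, he⟩ := Ins_iff.1 hi
        exact ⟨⟨⟨L', R'⟩, d⟩, ⟨⟨hl, hr⟩, hd⟩, he⟩

theorem Le.size_eq {T' T : BinTree} (h : Le T' T) : T'.size = T.size := by
  induction h with
  | leaf => simp
  | node _ _ hi ihl ihr =>
    obtain ⟨d, hd, he⟩ := Ins_iff.1 hi
    rw [← he, size_ins hd, ihl, ihr, size]

/-- Generating polynomial of the trees below `T` by left border. -/
noncomputable def bp (T : BinTree) : ℚ[X] := ∑ T' ∈ lowers T, X ^ T'.leftBorder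

theorem bp_leaf : bp leaf = 1 := by simp [bp, lowers, leftBorder]

theorem bp_node (L R : BinTree) :
    bp (node L R) = X * bp L * ∑ R' ∈ lowers R, ∑ d ∈ Finset.range (R'.leftBorder + 1), X ^ d := by
  classical
  unfold bp
  rw [lowers]
  rw [Finset.sum_image]
  · rw [Finset.sum_sigma, Finset.sum_product, Finset.mul_sum (s := lowers L), Finset.sum_mul]
    refine Finset.sum_congr rfl fun L' _ => ?_
    rw [Finset.mul_sum]
    refine Finset.sum_congr rfl fun R' _ => ?_
    rw [Finset.mul_sum]
    refine Finset.sum_congr rfl fun d hd => ?_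
    rw [leftBorder_ins (by simpa [Nat.lt_succ_iff] using hd)]
    ring
  · rintro ⟨⟨L1, R1⟩, d1⟩ h1 ⟨⟨L2, R2⟩, d2⟩ h2 he
    simp only [Finset.coe_sigma, Set.mem_sigma_iff, Finset.mem_coe, Finset.mem_product,
      Finset.mem_range, Nat.lt_succ_iff, mem_lowers] at h1 h2
    obtain ⟨rfl, rfl, rfl⟩ := ins_inj (h1.1.1.size_eq.trans h2.1.1.size_eq.symm) h1.2 h2.2 he
    rfl

theorem bp_node_mul (L R : BinTree) :
    (X - 1) * bp (node L R) = X * bp L * (X * bp R - C ((bp R).eval 1)) := by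
  have h : (∑ R' ∈ lowers R, ∑ d ∈ Finset.range (R'.leftBorder + 1), (X : ℚ[X]) ^ d) * (X - 1)
      = X * bp R - C ((bp R).eval 1) := by
    rw [Finset.sum_mul]
    simp only [geom_sum_mul, bp, eval_finsetSum, eval_pow, eval_X, one_pow, Finset.sum_sub_distrib,
      Finset.mul_sum, map_sum, map_one, pow_succ']
  rw [bp_node, ← h]; ring

open Classical in
/-- Trees of height at most `n`. -/
noncomputable def treesH : ℕ → Finset BinTree
  | 0 => {leaf}
  | n + 1 => {leaf} ∪ (treesH n ×ˢ treesH n).image fun p => node p.1 p.2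

theorem mem_treesH : ∀ {n : ℕ} {T : BinTree}, T.size ≤ n → T ∈ treesH n
  | 0, leaf, _ => by simp [treesH]
  | 0, node _ _, h => by simp [size] at h
  | n + 1, leaf, _ => by simp [treesH]
  | n + 1, node L R, h => by
    simp only [size] at h
    simp only [treesH, Finset.mem_union, Finset.mem_image, Finset.mem_product]
    exact .inr ⟨(L, R), ⟨mem_treesH (T := L) (by omega), mem_treesH (T := R) (by omega)⟩, rfl⟩

/-- Trees of size `n`. -/
noncomputable def trees (n : ℕ) : Finset BinTree := (treesH n).filter fun T => T.size = n

theorem mem_trees {n : ℕ} {T : BinTree} : T ∈ trees n ↔ T.size = n := by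
  simp only [trees, Finset.mem_filter, and_iff_right_iff_imp]
  exact fun h => mem_treesH h.le

/-- Generating polynomial of intervals of size `n`. -/
noncomputable def gp (n : ℕ) : ℚ[X] := ∑ T ∈ trees n, bp T

theorem gp_zero : gp 0 = 1 := by
  have : trees 0 = {leaf} := by
    ext T
    rw [mem_trees, Finset.mem_singleton]
    cases T <;> simp [size]
  simp [gp, this, bp_leaf]

theorem gp_succ (n : ℕ) : (X - 1) * gp (n + 1) =
    ∑ p ∈ Finset.HasAntidiagonal.antidiagonal n, X * gp p.1 * (X * gp p.2 - C ((gp p.2).eval 1)) := by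
  classical
  have h : trees (n + 1) = ((Finset.HasAntidiagonal.antidiagonal n).sigma fun p => trees p.1 ×ˢ trees p.2).image
      fun q => node q.2.1 q.2.2 := by
    ext T
    simp only [mem_trees, Finset.mem_image, Finset.mem_sigma, Finset.HasAntidiagonal.mem_antidiagonal,
      Finset.mem_product]
    constructor
    · intro hT
      cases T with
      | leaf => simp [size] at hT
      | node L R =>
        exact ⟨⟨(L.size, R.size), (L, R)⟩, ⟨by simpa [size] using hT, rfl, rfl⟩, rfl⟩
    · rintro ⟨⟨⟨i, j⟩, L, R⟩, ⟨h1, h2, h3⟩, rfl⟩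
      simp only at h1 h2 h3
      simp only [size]; omega
  rw [gp, h, Finset.sum_image, Finset.sum_sigma, Finset.mul_sum]
  · refine Finset.sum_congr rfl fun p _ => ?_
    simp only [Finset.sum_product, Finset.mul_sum, bp_node_mul, gp, eval_finsetSum, map_sum,
      ← Finset.sum_sub_distrib, Finset.sum_mul]
    rw [Finset.sum_comm]
  · rintro ⟨⟨i, j⟩, L, R⟩ h1 ⟨⟨i', j'⟩, L', R'⟩ h2 he
    simp only [Finset.coe_sigma, Set.mem_sigma_iff, Finset.mem_coe, Finset.mem_product,
      mem_trees] at h1 h2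
    simp only [node.injEq] at he
    obtain ⟨rfl, rfl⟩ := he
    obtain ⟨-, rfl, rfl⟩ := h1
    obtain ⟨-, rfl, rfl⟩ := h2
    rfl

theorem card_eq_gp (n : ℕ) :
    (Nat.card {p : BinTree × BinTree // p.1.size = n ∧ p.2.size = n ∧ TamariLE p.1 p.2} : ℚ) =
      (gp n).eval 1 := by
  classical
  have e : {p : BinTree × BinTree // p.1.size = n ∧ p.2.size = n ∧ TamariLE p.1 p.2} ≃
      ((trees n).sigma fun T => lowers T) :=
    { toFun := fun p => ⟨⟨p.1.2, p.1.1⟩, by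
        simp only [Finset.mem_sigma, mem_trees, mem_lowers, ← tam_iff_le]
        exact p.2.2⟩
      invFun := fun q => ⟨(q.1.2, q.1.1), by
        have := q.2
        simp only [Finset.mem_sigma, mem_trees, mem_lowers] at this
        exact ⟨this.2.size_eq.trans this.1, this.1, tam_iff_le.2 this.2⟩⟩
      left_inv := fun p => rfl
      right_inv := fun q => rfl }
  rw [Nat.card_congr e, Nat.card_eq_fintype_card, Fintype.card_coe, Finset.card_sigma]
  simp [gp, bp, eval_finsetSum]

end BinTree

namespace TamariSeries

open PowerSeries in
theorem exists_fix {R : Type*} [CommRing R] (g : R⟦X⟧ → R⟦X⟧)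
    (hg : ∀ a b, a - b ∣ g a - g b) : ∃ Y : R⟦X⟧, Y = 1 + (PowerSeries.X : R⟦X⟧) * g Y := by
  set Φ : R⟦X⟧ → R⟦X⟧ := fun a => 1 + (PowerSeries.X : R⟦X⟧) * g a with hΦ
  have hc : ∀ m a b, (PowerSeries.X : R⟦X⟧) ^ m ∣ a - b → (PowerSeries.X : R⟦X⟧) ^ (m + 1) ∣ Φ a - Φ b := by
    intro m a b h
    have : Φ a - Φ b = (PowerSeries.X : R⟦X⟧) * (g a - g b) := by simp only [hΦ]; ring
    rw [this, pow_succ']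
    exact mul_dvd_mul_left _ (h.trans (hg a b))
  have hs : ∀ m, (PowerSeries.X : R⟦X⟧) ^ m ∣ Φ^[m + 1] 0 - Φ^[m] 0 := by
    intro m
    induction m with
    | zero => simp
    | succ m ih =>
      rw [Function.iterate_succ_apply' Φ (m + 1), Function.iterate_succ_apply' Φ m]
      rw [Function.iterate_succ_apply' Φ m] at ih
      exact hc m _ _ ih
  have hj : ∀ m j, (PowerSeries.X : R⟦X⟧) ^ m ∣ Φ^[m + j] 0 - Φ^[m] 0 := by
    intro m j
    induction j with
    | zero => simp
    | succ j ih =>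
      have := dvd_add ((pow_dvd_pow _ (Nat.le_add_right m j)).trans (hs (m + j))) ih
      simpa [add_assoc] using this
  set Y : R⟦X⟧ := PowerSeries.mk fun n => PowerSeries.coeff n (Φ^[n + 1] 0) with hY
  have hYm : ∀ m, (PowerSeries.X : R⟦X⟧) ^ m ∣ Y - Φ^[m] 0 := by
    intro m
    rw [PowerSeries.X_pow_dvd_iff]
    intro n hn
    obtain ⟨j, rfl⟩ := Nat.exists_eq_add_of_le (Nat.succ_le_of_lt hn)
    have := (PowerSeries.X_pow_dvd_iff.1 (hj (n + 1) j)) n (Nat.lt_succ_self n)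
    rw [map_sub, sub_eq_zero] at this
    rw [map_sub, hY, PowerSeries.coeff_mk, sub_eq_zero, ← this]
  refine ⟨Y, ?_⟩
  rw [← sub_eq_zero]
  ext n
  have h1 := hYm (n + 1)
  have h2 := hc n _ _ (hYm n)
  rw [← Function.iterate_succ_apply' Φ n] at h2
  have h3 := dvd_sub h1 h2
  rw [sub_sub_sub_cancel_right] at h3
  exact (PowerSeries.X_pow_dvd_iff.1 h3) n (Nat.lt_succ_self n)

/-- Coefficients of powers of the quaternary series. -/
theorem coeff_pow {Y : PowerSeries ℚ} (h : Y = 1 + PowerSeries.X * Y ^ 4) (n : ℕ) : ∀ k : ℕ,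
    PowerSeries.coeff n (Y ^ (k + 1)) =
      (k + 1) * (Nat.factorial (4 * n + k) : ℚ) /
        ((Nat.factorial n : ℚ) * (Nat.factorial (3 * n + k + 1) : ℚ)) := by
  have hr : ∀ k, Y ^ (k + 1) = Y ^ k + PowerSeries.X * Y ^ (k + 3 + 1) := by
    intro k
    calc Y ^ (k + 1) = Y ^ k * Y := pow_succ _ _
      _ = Y ^ k * (1 + PowerSeries.X * Y ^ 4) := by rw [← h]
      _ = _ := by ring
  induction n with
  | zero =>
    intro k
    have h0 : PowerSeries.constantCoeff Y = 1 := by rw [h]; simp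
    have : (Nat.factorial k : ℚ) ≠ 0 := by positivity
    simp [h0, Nat.factorial_succ]
    field_simp
  | succ n ih =>
    intro k
    induction k with
    | zero =>
      rw [hr, map_add, PowerSeries.coeff_succ_X_mul, ih]
      have e1 : 4 * (n + 1) + 0 = (4 * n + 3) + 1 := by ring
      have e2 : 3 * (n + 1) + 0 + 1 = 3 * n + 4 := by ring
      have e3 : 3 * n + (0 + 3) + 1 = 3 * n + 4 := by ring
      have e4 : 4 * n + (0 + 3) = 4 * n + 3 := by ring
      rw [e1, e2, e3, e4, Nat.factorial_succ (4 * n + 3), Nat.factorial_succ n]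
      have : (Nat.factorial (3 * n + 4) : ℚ) ≠ 0 := by positivity
      have : (Nat.factorial n : ℚ) ≠ 0 := by positivity
      simp [PowerSeries.coeff_one]
      field_simp
      ring
    | succ k ihk =>
      rw [hr, map_add, PowerSeries.coeff_succ_X_mul, ih, ihk]
      have e1 : 4 * (n + 1) + (k + 1) = (4 * n + k + 4) + 1 := by ring
      have e2 : 4 * (n + 1) + k = 4 * n + k + 4 := by ring
      have e3 : 4 * n + (k + 1 + 3) = 4 * n + k + 4 := by ring
      have e4 : 3 * (n + 1) + (k + 1) + 1 = (3 * n + k + 4) + 1 := by ring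
      have e5 : 3 * (n + 1) + k + 1 = 3 * n + k + 4 := by ring
      have e6 : 3 * n + (k + 1 + 3) + 1 = (3 * n + k + 4) + 1 := by ring
      rw [e1, e2, e3, e4, e5, e6, Nat.factorial_succ (4 * n + k + 4), Nat.factorial_succ n,
        Nat.factorial_succ (3 * n + k + 4)]
      have : (Nat.factorial (3 * n + k + 4) : ℚ) ≠ 0 := by positivity
      have : (Nat.factorial n : ℚ) ≠ 0 := by positivity
      push_cast
      field_simp
      ring

theorem functional {R : Type*} [CommRing R] (t x Y c : R)
    (hY : Y = 1 + t * Y ^ 4) (hc : c = 1 + t * (x * Y ^ 2 * c ^ 2)) :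
    (x - 1) * (Y * c - (Y - 1) * c ^ 2) = (x - 1) + t * (x * (Y * c - (Y - 1) * c ^ 2) *
      (x * (Y * c - (Y - 1) * c ^ 2) - Y ^ 2 * (2 - Y))) := by
  have h1 : x * c ^ 2 * (Y - 1) = Y ^ 2 * (c - 1) := by
    linear_combination x * c ^ 2 * hY - Y ^ 2 * hc
  have h2 : (x - 1) * Y ^ 2 * c * (1 - (Y - 1) * c) =
      (Y - (Y - 1) * c) * (x * c * (Y - (Y - 1) * c) - Y ^ 2 * (2 - Y)) := by
    linear_combination -(Y * (Y - 2) + (Y - 1) * c) * h1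
  have h3 : Y * c - (Y - 1) * c ^ 2 - 1 = t * x * Y ^ 2 * c ^ 2 * (1 - (Y - 1) * c) := by
    linear_combination (1 - (Y - 1) * c) * hc
  linear_combination (x - 1) * h3 + t * x * c * h2

theorem gp_eval {Y : PowerSeries ℚ} (h : Y = 1 + PowerSeries.X * Y ^ 4) (n : ℕ) :
    (gp n).eval 1 = PowerSeries.coeff n (Y ^ 2 * (2 - Y)) := by
  set Z : PowerSeries ℚ[X] := PowerSeries.map (C : ℚ →+* ℚ[X]) Y with hZ
  have hZ4 : Z = 1 + PowerSeries.X * Z ^ 4 := by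
    have := congrArg (PowerSeries.map (C : ℚ →+* ℚ[X])) h
    simpa only [map_add, map_mul, map_pow, map_one, PowerSeries.map_X] using this
  set x : PowerSeries ℚ[X] := PowerSeries.C (X : ℚ[X]) with hx
  obtain ⟨c, hc⟩ := exists_fix (fun c : PowerSeries ℚ[X] => x * Z ^ 2 * c ^ 2) (by
    intro a b
    exact ⟨x * Z ^ 2 * (a + b), by ring⟩)
  have hfun := functional _ x Z c hZ4 hc
  set F : PowerSeries ℚ[X] := Z * c - (Z - 1) * c ^ 2 with hF
  set f : PowerSeries ℚ := Y ^ 2 * (2 - Y) with hf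
  have hfm : Z ^ 2 * (2 - Z) = PowerSeries.map (C : ℚ →+* ℚ[X]) f := by
    simp only [hf, hZ, map_mul, map_pow, map_sub, map_ofNat]
  -- evaluation at one
  set ev := PowerSeries.map (evalRingHom (1 : ℚ)) with hev
  have hevZ : ev Z = Y := by
    ext m
    simp [hev, hZ]
  have hevx : ev x = 1 := by simp [hev, hx]
  have hevc : ev c = Y := by
    have h1 : ev c = 1 + PowerSeries.X * (Y ^ 2 * (ev c) ^ 2) := by
      have := congrArg ev hc
      have hX : ev PowerSeries.X = PowerSeries.X := PowerSeries.map_X _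
      simpa only [map_add, map_mul, map_pow, map_one, hevZ, hevx, one_mul, hX] using this
    have h2 : (ev c - Y) * (1 - PowerSeries.X * (Y ^ 2 * (ev c + Y))) = 0 := by
      linear_combination h1 - h
    rcases mul_eq_zero.1 h2 with h3 | h3
    · exact sub_eq_zero.1 h3
    · have := congrArg PowerSeries.constantCoeff h3
      simp at this
  have hevF : ev F = f := by
    simp only [hF, hf, map_sub, map_mul, map_pow, map_one, hevZ, hevc]
    ring
  have hFf : ∀ m, (PowerSeries.coeff m F).eval 1 = PowerSeries.coeff m f := by
    intro m
    rw [← hevF]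
    simp [hev]
  -- the coefficients of `F`
  have hF0 : PowerSeries.coeff 0 F = 1 := by
    have hz : PowerSeries.constantCoeff Z = 1 := by rw [hZ4]; simp
    have hc0 : PowerSeries.constantCoeff c = 1 := by rw [hc]; simp
    simp [hF, hz, hc0]
  have hFs : ∀ m, (X - 1) * PowerSeries.coeff (m + 1) F =
      ∑ p ∈ Finset.HasAntidiagonal.antidiagonal m, X * PowerSeries.coeff p.1 F *
        (X * PowerSeries.coeff p.2 F - C ((PowerSeries.coeff p.2 F).eval 1)) := by
    intro m
    have h1 : x - 1 = PowerSeries.C (X - 1 : ℚ[X]) := by simp [hx]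
    have := congrArg (PowerSeries.coeff (m + 1)) hfun
    rw [h1, hfm, map_add, PowerSeries.coeff_C_mul, PowerSeries.coeff_succ_X_mul,
      PowerSeries.coeff_C, if_neg (Nat.succ_ne_zero m), zero_add, PowerSeries.coeff_mul] at this
    rw [this]
    refine Finset.sum_congr rfl fun p _ => ?_
    rw [map_sub, hx, PowerSeries.coeff_C_mul, PowerSeries.coeff_C_mul, PowerSeries.coeff_map, hFf]
  have key : ∀ m, gp m = PowerSeries.coeff m F := by
    intro m
    induction m using Nat.strong_induction_on with
    | _ m ih =>
      cases m with
      | zero => rw [gp_zero, hF0]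
      | succ m =>
        have hne : (X - 1 : ℚ[X]) ≠ 0 := X_sub_C_ne_zero 1
        apply mul_left_cancel₀ hne
        rw [gp_succ, hFs]
        refine Finset.sum_congr rfl fun p hp => ?_
        rw [Finset.HasAntidiagonal.mem_antidiagonal] at hp
        rw [ih p.1 (by omega), ih p.2 (by omega)]
  rw [key, hFf]

end TamariSeries

/-- For every `n ≥ 0`, the number of intervals of the Tamari lattice of size
`n`, i.e. the number of ordered pairs `(T,T')` of binary trees of size `n` with `T ≤ T'`
in the Tamari order, equals `2·(4n+1)! / ((n+1)!·(3n+2)!)`. -/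
theorem card_tamari_intervals (n : ℕ) :
    (Nat.card {p : BinTree × BinTree // p.1.size = n ∧ p.2.size = n ∧ TamariLE p.1 p.2} : ℚ) =
      2 * (Nat.factorial (4 * n + 1) : ℚ) /
        ((Nat.factorial (n + 1) : ℚ) * (Nat.factorial (3 * n + 2) : ℚ)) := by
  rw [card_eq_gp]
  obtain ⟨Y, hY⟩ := TamariSeries.exists_fix (fun a : PowerSeries ℚ => a ^ 4)
    (fun a b => sub_dvd_pow_sub_pow a b 4)
  have e : Y ^ 2 * (2 - Y) = Y ^ (1 + 1) + Y ^ (1 + 1) - Y ^ (2 + 1) := by ring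
  rw [TamariSeries.gp_eval hY, e, map_sub, map_add, TamariSeries.coeff_pow hY,
    TamariSeries.coeff_pow hY]
  have e1 : 4 * n + 2 = (4 * n + 1) + 1 := by ring
  have e2 : 3 * n + 1 + 1 = 3 * n + 2 := by ring
  have e3 : 3 * n + 2 + 1 = (3 * n + 2) + 1 := by ring
  rw [e2, e1, Nat.factorial_succ (4 * n + 1), Nat.factorial_succ (3 * n + 2), Nat.factorial_succ n]
  have : (Nat.factorial (3 * n + 2) : ℚ) ≠ 0 := by positivity
  have : (Nat.factorial n : ℚ) ≠ 0 := by positivity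
  push_cast
  field_simp
  ring
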